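/- Let e ∈ ℤ. If e is even let L₁⁰ = {(x, x*) ∈ ℚ₂^{2m} : x_i ∈ 2^{e/2+1}ℤ₂ and x*_i ∈ 2^{e/2}ℤ₂ for all i}; if e is odd let L₁⁰ = {(x, x*) : x_i, x*_i ∈ 2^{(e+1)/2}ℤ₂ for all i}. Suppose g ∈ Sp_{2m}(ℚ₂) satisfies L₁⁰·g ⊆ L₁⁰. Then q_g(l) ∈ 2^e ℤ₂ for every l ∈ L₁⁰; consequently ψ(q_g(l)) = 1 for every character ψ of the additive group of ℚ₂ trivial on 2^e ℤ₂. -/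

import Mathlib

open Matrix

/-- `x ∈ 2^e ℤ₂` inside `ℚ₂`. -/
def inTwoPowLattice (e : ℤ) (x : ℚ_[2]) : Prop :=
  ∃ z : ℤ_[2], x = (2 : ℚ_[2]) ^ e * (z : ℚ_[2])

/-- `B((x,x*),(y,y*)) = Σ_{i=1}^m x_i y*_i`. -/
noncomputable def BfP (m : ℕ) (w w' : (Fin m ⊕ Fin m) → ℚ_[2]) : ℚ_[2] :=
  ∑ i : Fin m, w (Sum.inl i) * w' (Sum.inr i)

/-- Projection of `w = (x, x*)` to `(x, 0)`. -/
noncomputable def xpart (m : ℕ) (w : (Fin m ⊕ Fin m) → ℚ_[2]) : (Fin m ⊕ Fin m) → ℚ_[2] :=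
  fun p => match p with
  | Sum.inl i => w (Sum.inl i)
  | Sum.inr _ => 0

/-- Projection of `w = (x, x*)` to `(0, x*)`. -/
noncomputable def spart (m : ℕ) (w : (Fin m ⊕ Fin m) → ℚ_[2]) : (Fin m ⊕ Fin m) → ℚ_[2] :=
  fun p => match p with
  | Sum.inl _ => 0
  | Sum.inr i => w (Sum.inr i)

/-- `q_g((x,x*)) = ½B(xa, xb) + ½B(x*c, x*d) + B(x*c, xb)`, for
`g = [[a, b], [c, d]]` acting on row vectors on the right. -/
noncomputable def qform (m : ℕ) (g : Matrix (Fin m ⊕ Fin m) (Fin m ⊕ Fin m) ℚ_[2])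
    (w : (Fin m ⊕ Fin m) → ℚ_[2]) : ℚ_[2] :=
  BfP m (Matrix.vecMul (xpart m w) g) (Matrix.vecMul (xpart m w) g) / 2
    + BfP m (Matrix.vecMul (spart m w) g) (Matrix.vecMul (spart m w) g) / 2
    + BfP m (Matrix.vecMul (spart m w) g) (Matrix.vecMul (xpart m w) g)

/-- `J = [[0, I_m], [−I_m, 0]]`. -/
def Jmat (m : ℕ) (R : Type*) [CommRing R] :
    Matrix (Fin m ⊕ Fin m) (Fin m ⊕ Fin m) R :=
  Matrix.fromBlocks 0 1 (-1) 0

/-- `Sp_{2m}(R) = {A : A J Aᵀ = J}`. -/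
def SpSet (m : ℕ) (R : Type*) [CommRing R] :
    Set (Matrix (Fin m ⊕ Fin m) (Fin m ⊕ Fin m) R) :=
  {A | A * Jmat m R * Aᵀ = Jmat m R}

/-- The lattice `L₁⁰`: if `e` is even it is
`2^{e/2+1}ℤ₂^m ⊕ 2^{e/2}ℤ₂^m`, and if `e` is odd it is
`2^{(e+1)/2}ℤ₂^m ⊕ 2^{(e+1)/2}ℤ₂^m`. -/
def L10 (m : ℕ) (e : ℤ) : Set ((Fin m ⊕ Fin m) → ℚ_[2]) :=
  {w | ∀ i : Fin m,
      inTwoPowLattice (if e % 2 = 0 then e / 2 + 1 else (e + 1) / 2) (w (Sum.inl i)) ∧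
      inTwoPowLattice (if e % 2 = 0 then e / 2 else (e + 1) / 2) (w (Sum.inr i))}

theorem inTwoPowLattice_zero (e : ℤ) : inTwoPowLattice e 0 := ⟨0, by simp⟩

theorem inTwoPowLattice.add {e : ℤ} {x y : ℚ_[2]} (hx : inTwoPowLattice e x)
    (hy : inTwoPowLattice e y) : inTwoPowLattice e (x + y) := by
  obtain ⟨a, rfl⟩ := hx
  obtain ⟨b, rfl⟩ := hy
  exact ⟨a + b, by push_cast; ring⟩

theorem inTwoPowLattice.mul {r s : ℤ} {x y : ℚ_[2]} (hx : inTwoPowLattice r x)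
    (hy : inTwoPowLattice s y) : inTwoPowLattice (r + s) (x * y) := by
  obtain ⟨a, rfl⟩ := hx
  obtain ⟨b, rfl⟩ := hy
  exact ⟨a * b, by rw [zpow_add₀ two_ne_zero]; push_cast; ring⟩

theorem inTwoPowLattice.sum {ι : Type*} {e : ℤ} {s : Finset ι} {f : ι → ℚ_[2]}
    (hf : ∀ i ∈ s, inTwoPowLattice e (f i)) : inTwoPowLattice e (∑ i ∈ s, f i) :=
  Finset.sum_induction f (inTwoPowLattice e) (fun _ _ => inTwoPowLattice.add)
    (inTwoPowLattice_zero e) hf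

theorem inTwoPowLattice.div_two {e : ℤ} {x : ℚ_[2]} (hx : inTwoPowLattice (e + 1) x) :
    inTwoPowLattice e (x / 2) := by
  obtain ⟨a, rfl⟩ := hx
  exact ⟨a, by rw [zpow_add_one₀ two_ne_zero]; ring⟩

theorem inTwoPowLattice.of_add_one {e : ℤ} {x : ℚ_[2]} (hx : inTwoPowLattice (e + 1) x) :
    inTwoPowLattice e x := by
  have h := hx.div_two.add hx.div_two
  rwa [add_halves] at h

theorem xpart_mem_L10 {m : ℕ} {e : ℤ} {w : (Fin m ⊕ Fin m) → ℚ_[2]} (hw : w ∈ L10 m e) :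
    xpart m w ∈ L10 m e :=
  fun i => ⟨(hw i).1, inTwoPowLattice_zero _⟩

theorem spart_mem_L10 {m : ℕ} {e : ℤ} {w : (Fin m ⊕ Fin m) → ℚ_[2]} (hw : w ∈ L10 m e) :
    spart m w ∈ L10 m e :=
  fun i => ⟨inTwoPowLattice_zero _, (hw i).2⟩

theorem BfP_mem_of_mem_L10 {m : ℕ} {e : ℤ} {w w' : (Fin m ⊕ Fin m) → ℚ_[2]}
    (hw : w ∈ L10 m e) (hw' : w' ∈ L10 m e) : inTwoPowLattice (e + 1) (BfP m w w') := by
  refine inTwoPowLattice.sum fun i _ => ?_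
  have h := (hw i).1.mul (hw' i).2
  convert h using 1
  split_ifs <;> omega

theorem qform_mem_of_stable {m : ℕ} {e : ℤ} {g : Matrix (Fin m ⊕ Fin m) (Fin m ⊕ Fin m) ℚ_[2]}
    (hstab : ∀ w ∈ L10 m e, Matrix.vecMul w g ∈ L10 m e) {l : (Fin m ⊕ Fin m) → ℚ_[2]}
    (hl : l ∈ L10 m e) : inTwoPowLattice e (qform m g l) := by
  have hx := hstab _ (xpart_mem_L10 hl)
  have hs := hstab _ (spart_mem_L10 hl)
  exact ((BfP_mem_of_mem_L10 hx hx).div_two.add (BfP_mem_of_mem_L10 hs hs).div_two).add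
    (BfP_mem_of_mem_L10 hs hx).of_add_one

/-- If `g ∈ Sp_{2m}(ℚ₂)` satisfies `L₁⁰ · g ⊆ L₁⁰` then `q_g(l) ∈ 2^e ℤ₂` for
all `l ∈ L₁⁰`; consequently `ψ(q_g(l)) = 1` for every additive character `ψ`
of `ℚ₂` trivial on `2^e ℤ₂`. -/
theorem stmt_16 (m : ℕ) (hm : 1 ≤ m) (e : ℤ)
    (g : Matrix (Fin m ⊕ Fin m) (Fin m ⊕ Fin m) ℚ_[2])
    (hgSp : g ∈ SpSet m ℚ_[2])
    (hstab : ∀ w ∈ L10 m e, Matrix.vecMul w g ∈ L10 m e) :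
    (∀ l ∈ L10 m e, inTwoPowLattice e (qform m g l)) ∧
    (∀ ψ : ℚ_[2] → ℂˣ, (∀ a b, ψ (a + b) = ψ a * ψ b) →
        (∀ x, inTwoPowLattice e x → ψ x = 1) →
        ∀ l ∈ L10 m e, ψ (qform m g l) = 1) := by
  exact ⟨fun _ hl => qform_mem_of_stable hstab hl,
    fun _ _ hψ _ hl => hψ _ (qform_mem_of_stable hstab hl)⟩
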